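/- Let R = ⊕_{i≥0} R_i be a commutative nonnegatively graded ring that is finitely generated as an algebra over its degree-zero part R_0, where R_0 is a Noetherian complete local ring. Let I ⊆ R be a homogeneous (graded) ideal whose degree-zero component I_0 = I ∩ R_0 equals the maximal ideal of R_0. Then for every finitely generated graded R-module M and every i ∈ ℤ, the natural map M_i → lim_n (M/I^n M)_i from the degree-i component of M to the inverse limit of the degree-i components of the quotients M/I^n M is an isomorphism. -/

import Mathlib

/-!
STATEMENT 0: Let `R = ⊕_{i≥0} R_i` be a commutative nonnegatively graded ring, finitely
generated as an algebra over its degree-zero part `R₀`, where `R₀` is a Noetherian complete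
local ring.  Let `I ⊆ R` be a homogeneous ideal with `I ∩ R₀` equal to the maximal ideal of
`R₀`.  Then for every finitely generated graded `R`-module `M` and every `i ∈ ℤ`, the natural
map `M_i → lim_n (M/I^n M)_i` is an isomorphism.

We model the gradings internally (`𝒜 : ℤ → AddSubgroup R` a `GradedRing` vanishing in negative
degrees, `ℳ : ℤ → AddSubgroup M` a compatible decomposition of `M`).  Since `I` is homogeneous,
`I^n M` is a graded submodule, so the degree-`i` component of `M / I^n M` is canonically
`M_i / (I^n M ∩ M_i)`; the inverse limit is realized as the subgroup of compatible sequences in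
`∀ n, M_i / (I^n M ∩ M_i)`, and the natural map sends `x ∈ M_i` to the sequence of its classes.
-/

open DirectSum

namespace Statement0

variable {G : Type*} [AddCommGroup G]

/-- The transition maps between the quotients along a decreasing filtration `p` by subgroups. -/
def trans (p : ℕ → AddSubgroup G) (hp : ∀ ⦃m n : ℕ⦄, m ≤ n → p n ≤ p m)
    {m n : ℕ} (h : m ≤ n) : G ⧸ p n →+ G ⧸ p m :=
  QuotientAddGroup.map _ _ (AddMonoidHom.id G) (fun x hx => hp h hx)

@[simp] lemma trans_mk (p : ℕ → AddSubgroup G) (hp : ∀ ⦃m n : ℕ⦄, m ≤ n → p n ≤ p m)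
    {m n : ℕ} (h : m ≤ n) (x : G) :
    trans p hp h ((x : G ⧸ p n)) = (x : G ⧸ p m) := rfl

/-- The inverse limit `lim_n G / p n` of the quotients along a decreasing filtration,
realized as the subgroup of compatible sequences. -/
def invLimit (p : ℕ → AddSubgroup G) (hp : ∀ ⦃m n : ℕ⦄, m ≤ n → p n ≤ p m) :
    AddSubgroup (∀ n, G ⧸ p n) where
  carrier := {g | ∀ ⦃m n : ℕ⦄ (h : m ≤ n), trans p hp h (g n) = g m}
  add_mem' := by
    intro a b ha hb m n h
    rw [Pi.add_apply, Pi.add_apply, map_add, ha h, hb h]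
  zero_mem' := by
    intro m n h
    simp only [Pi.zero_apply, map_zero]
  neg_mem' := by
    intro a ha m n h
    rw [Pi.neg_apply, Pi.neg_apply, map_neg, ha h]

/-- The natural map from `G` to the inverse limit of the quotients `G / p n`. -/
def toInvLimit (p : ℕ → AddSubgroup G) (hp : ∀ ⦃m n : ℕ⦄, m ≤ n → p n ≤ p m) :
    G → invLimit p hp :=
  fun x => ⟨fun n => (x : G ⧸ p n), fun m n h => trans_mk p hp h x⟩

end Statement0

namespace Statement0

/-- A finite module over a complete Noetherian local ring is complete. -/
lemma isAdicComplete_of_finite {A N : Type*} [CommRing A] [IsNoetherianRing A] [IsLocalRing A]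
    [IsAdicComplete (IsLocalRing.maximalIdeal A) A] [AddCommGroup N] [Module A N]
    [Module.Finite A N] : IsAdicComplete (IsLocalRing.maximalIdeal A) N where
  toIsHausdorff := inferInstance
  toIsPrecomplete := by
    rw [← AdicCompletion.of_surjective_iff]
    intro y
    obtain ⟨t, rfl⟩ := AdicCompletion.ofTensorProduct_surjective_of_finite _ N y
    induction t with
    | zero => exact ⟨0, by simp⟩
    | add a b ha hb =>
      obtain ⟨x, hx⟩ := ha
      obtain ⟨z, hz⟩ := hb
      exact ⟨x + z, by simp [hx, hz]⟩
    | tmul r x =>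
      obtain ⟨r, rfl⟩ := AdicCompletion.of_surjective (IsLocalRing.maximalIdeal A) A r
      refine ⟨r • x, ?_⟩
      ext n
      simp only [AdicCompletion.ofTensorProduct_tmul, AdicCompletion.smul_eval, map_smul]
      rfl

/-- If a filtration `p` is cofinal with the `J`-adic filtration of a `J`-adically complete module,
then the natural map to the inverse limit along `p` is bijective. -/
lemma toInvLimit_bijective {A N G : Type*} [CommRing A] (J : Ideal A) [AddCommGroup N]
    [Module A N] [IsAdicComplete J N] [AddCommGroup G] (e : G ≃+ N)
    (p : ℕ → AddSubgroup G) (hp : ∀ ⦃m n : ℕ⦄, m ≤ n → p n ≤ p m) (c : ℕ)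
    (hle : ∀ n x, e x ∈ (J ^ n • ⊤ : Submodule A N) → x ∈ p n)
    (hge : ∀ n x, x ∈ p (n + c) → e x ∈ (J ^ n • ⊤ : Submodule A N)) :
    Function.Bijective (toInvLimit p hp) := by
  constructor
  · intro x y hxy
    have hmem : ∀ n, x - y ∈ p n := fun n => by
      have h : (x : G ⧸ p n) = y := congrFun (congrArg Subtype.val hxy) n
      rw [eq_comm, QuotientAddGroup.eq] at h
      rwa [sub_eq_neg_add]
    have h0 : e (x - y) = 0 := IsHausdorff.haus (I := J) inferInstance _ fun n => by
      rw [SModEq.zero]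
      exact hge n _ (hmem _)
    rwa [map_eq_zero_iff e e.injective, sub_eq_zero] at h0
  · rintro ⟨g, hg⟩
    choose y hy using fun n => QuotientAddGroup.mk_surjective (g n)
    have hsub : ∀ {m n}, m ≤ n → y m - y n ∈ p m := fun {m n} h => by
      have h' := hg h
      rw [← hy n, ← hy m, trans_mk, QuotientAddGroup.eq] at h'
      rwa [sub_eq_neg_add]
    obtain ⟨L, hL⟩ := IsPrecomplete.prec (I := J) inferInstance
      (f := fun n => e (y (n + c))) fun {m n} h => by
        rw [SModEq.sub_mem, ← map_sub]
        exact hge _ _ (hsub (by lia))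
    refine ⟨e.symm L, Subtype.ext (funext fun n => ?_)⟩
    change ((e.symm L : G) : G ⧸ p n) = g n
    rw [← hy n, eq_comm, QuotientAddGroup.eq, ← sub_eq_neg_add]
    have h1 : y (n + c) - e.symm L ∈ p n := hle n _ (by
      rw [map_sub, e.apply_symm_apply, ← SModEq.sub_mem]
      exact hL n)
    have h2 := add_mem (hsub (Nat.le_add_right n c)) h1
    rw [sub_add_sub_cancel, ← neg_mem_iff, neg_sub] at h2
    exact h2

section Graded

variable {A R M : Type*} [CommRing A] [CommRing R] [Algebra A R] [AddCommGroup M] [Module R M]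
  [Module A M] [IsScalarTower A R M] (𝒜 : ℤ → AddSubgroup R)
  (ℳ : ℤ → AddSubgroup M) [SetLike.GradedSMul 𝒜 ℳ]

/-- The degree-`i` component of `M` as a module over a ring mapping to the degree-zero part. -/
def component (h0 : ∀ a : A, algebraMap A R a ∈ 𝒜 0) (i : ℤ) : Submodule A M where
  __ := ℳ i
  smul_mem' a x hx := by
    have := SetLike.GradedSMul.smul_mem (h0 a) (show x ∈ ℳ i from hx)
    rwa [algebraMap_smul, vadd_eq_add, zero_add] at this

lemma smul_mem_pow_smul_component (h0 : ∀ a : A, algebraMap A R a ∈ 𝒜 0) (J : Ideal A)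
    {r : R} {k l : ℤ} (hr : r ∈ 𝒜 k) {y : M} (hy : y ∈ J • component 𝒜 ℳ h0 l) :
    r • y ∈ J • component 𝒜 ℳ h0 (k + l) := by
  induction hy using Submodule.smul_induction_on' with
  | smul c hc z hz =>
    rw [smul_comm]
    exact Submodule.smul_mem_smul hc
      (SetLike.GradedSMul.smul_mem (B := ℳ) hr (show z ∈ ℳ l from hz) : r • z ∈ ℳ (k + l))
  | add x _ y _ hx hy =>
    rw [smul_add]
    exact add_mem hx hy

/-- Extending scalars, `J ^ n` times a submodule lies in `I ^ n • M` when `J` maps into `I`. -/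
lemma mem_pow_smul_top_of_mem_pow_smul {I : Ideal R} {J : Ideal A}
    (hJI : ∀ a ∈ J, algebraMap A R a ∈ I) (n : ℕ) (N : Submodule A M) {x : M}
    (hx : x ∈ J ^ n • N) : x ∈ (I ^ n • ⊤ : Submodule R M) := by
  induction hx using Submodule.smul_induction_on' with
  | add x _ y _ hx hy => exact add_mem hx hy
  | smul a ha y _ =>
    rw [← algebraMap_smul R a y]
    refine Submodule.smul_mem_smul ?_ Submodule.mem_top
    have h : J ^ n ≤ (I ^ n).comap (algebraMap A R) :=
      (Ideal.pow_right_mono (fun a ha => hJI a ha) n).trans (Ideal.le_comap_pow _ n)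
    exact h ha

variable [GradedRing 𝒜] [Decomposition ℳ]

/-- The component of `r • x` in degree `k + i`, for `x` homogeneous of degree `i`. -/
lemma decompose_smul_add (r : R) {x : M} {i : ℤ} (hx : x ∈ ℳ i) (k : ℤ) :
    (decompose ℳ (r • x) (k + i) : M) = (decompose 𝒜 r k : R) • x := by
  induction r using Decomposition.inductionOn 𝒜 with
  | zero => simp
  | add a b ha hb => simp [add_smul, ha, hb]
  | @homogeneous j a =>
    have hax : (a : R) • x ∈ ℳ (j + i) := SetLike.GradedSMul.smul_mem a.2 hx
    obtain rfl | h := eq_or_ne j k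
    · rw [decompose_of_mem_same _ hax, decompose_of_mem_same _ a.2]
    · rw [decompose_of_mem_ne _ hax (by simpa using h), decompose_of_mem_ne _ a.2 h, zero_smul]

/-- Contracting the extension of a submodule of a graded component gives it back. -/
lemma decompose_mem_of_mem_span (h0 : ∀ a : A, algebraMap A R a ∈ 𝒜 0)
    (hsurj : ∀ r ∈ 𝒜 0, ∃ a : A, algebraMap A R a = r) {i : ℤ} (P : Submodule A M)
    (hP : P ≤ component 𝒜 ℳ h0 i) {x : M} (hx : x ∈ Submodule.span R (P : Set M)) :
    (decompose ℳ x i : M) ∈ P := by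
  suffices ∀ r : R, (decompose ℳ (r • x) i : M) ∈ P by simpa using this 1
  induction hx using Submodule.span_induction with
  | mem x hx =>
    intro r
    have h := decompose_smul_add 𝒜 ℳ r (hP hx) 0
    obtain ⟨a, ha⟩ := hsurj _ (decompose 𝒜 r 0).2
    rw [zero_add, ← ha, algebraMap_smul] at h
    rw [h]
    exact P.smul_mem a hx
  | zero => simp
  | add x y _ _ hx hy =>
    intro r
    simpa [smul_add] using add_mem (hx r) (hy r)
  | smul s x _ hx =>
    intro r
    rw [← mul_smul]
    exact hx _

lemma isNoetherian_component [IsNoetherian R M] (h0 : ∀ a : A, algebraMap A R a ∈ 𝒜 0)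
    (hsurj : ∀ r ∈ 𝒜 0, ∃ a : A, algebraMap A R a = r) (i : ℤ) :
    IsNoetherian A (component 𝒜 ℳ h0 i) := by
  rw [isNoetherian_submodule]
  have key : ∀ P Q : Submodule A M, P ≤ component 𝒜 ℳ h0 i → Q ≤ component 𝒜 ℳ h0 i →
      Submodule.span R (P : Set M) ≤ Submodule.span R (Q : Set M) → P ≤ Q := by
    intro P Q hP hQ h x hx
    have := decompose_mem_of_mem_span 𝒜 ℳ h0 hsurj Q hQ (h (Submodule.subset_span hx))
    rwa [decompose_of_mem_same ℳ (hP hx)] at this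
  intro P hP
  obtain ⟨s, hs, hspan⟩ := Submodule.fg_span_iff_fg_span_finset_subset (P : Set M) |>.mp
    (IsNoetherian.noetherian (Submodule.span R (P : Set M)))
  refine ⟨s, le_antisymm (Submodule.span_le.mpr hs) ?_⟩
  refine key _ _ hP ((Submodule.span_le.mpr hs).trans hP) ?_
  rw [hspan]
  exact Submodule.span_mono Submodule.subset_span

/-- A finitely generated graded module over a nonnegatively graded ring vanishes in
sufficiently negative degrees. -/
lemma exists_forall_lt_eq_bot [Module.Finite R M] (hneg : ∀ i : ℤ, i < 0 → 𝒜 i = ⊥) :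
    ∃ d : ℤ, ∀ j < d, ℳ j = ⊥ := by
  classical
  obtain ⟨s, hs⟩ := Module.Finite.fg_top (R := R) (M := M)
  obtain ⟨d, hd⟩ := (s.biUnion fun x => (decompose ℳ x).support).bddBelow
  have hd' : ∀ x ∈ s, ∀ j < d, (decompose ℳ x j : M) = 0 := by
    intro x hx j hj
    by_contra h
    refine absurd (hd (a := j) ?_) (not_le.mpr hj)
    simp only [Finset.coe_biUnion, Set.mem_iUnion]
    exact ⟨x, hx, by simpa using h⟩
  refine ⟨d, fun j hj => (AddSubgroup.eq_bot_iff_forall _).mpr fun x hx => ?_⟩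
  have key : ∀ y : M, ∀ j < d, (decompose ℳ y j : M) = 0 := by
    intro y
    have hy : y ∈ Submodule.span R (s : Set M) := hs ▸ Submodule.mem_top
    induction hy using Submodule.span_induction with
    | mem y hy => exact hd' y hy
    | zero => simp
    | add y z _ _ hy hz => intro j hj; simp [hy j hj, hz j hj]
    | smul r y _ hy =>
      intro j hj
      rw [← sum_support_decompose ℳ y, Finset.smul_sum, decompose_sum]
      rw [DFinsupp.finsetSum_apply, AddSubgroup.val_finsetSum]
      refine Finset.sum_eq_zero fun l _ => ?_
      have h := decompose_smul_add 𝒜 ℳ r (decompose ℳ y l).2 (j - l)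
      rw [sub_add_cancel] at h
      rw [h]
      obtain hl | hl := lt_or_ge l d
      · rw [hy l hl, smul_zero]
      · have h0 : (decompose 𝒜 r (j - l) : R) ∈ (⊥ : AddSubgroup R) :=
          hneg (j - l) (by lia) ▸ (decompose 𝒜 r (j - l)).2
        rw [AddSubgroup.mem_bot.mp h0, zero_smul]
  rw [← decompose_of_mem_same ℳ hx]
  exact key x j hj

/-- If `M` vanishes in degrees below `d` and `J` contains the degree-zero part of `I`, then the
degree-`j` component of `I ^ n • M` is contained in `J ^ (n - (j - d))` times that of `M`. -/
lemma decompose_mem_of_mem_pow_smul (h0 : ∀ a : A, algebraMap A R a ∈ 𝒜 0)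
    (hsurj : ∀ r ∈ 𝒜 0, ∃ a : A, algebraMap A R a = r)
    (hneg : ∀ i : ℤ, i < 0 → 𝒜 i = ⊥) {I : Ideal R} (hI : I.IsHomogeneous 𝒜) {J : Ideal A}
    (hIJ : ∀ a : A, algebraMap A R a ∈ I → a ∈ J) {d : ℤ} (hd : ∀ j < d, ℳ j = ⊥)
    (n : ℕ) {x : M} (hx : x ∈ (I ^ n • ⊤ : Submodule R M)) (j : ℤ) :
    (decompose ℳ x j : M) ∈ J ^ (n - (j - d).toNat) • component 𝒜 ℳ h0 j := by
  classical
  induction n generalizing x j with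
  | zero =>
    rw [Nat.zero_sub, pow_zero, Ideal.one_eq_top, Submodule.top_smul]
    exact (decompose ℳ x j).2
  | succ n ih =>
    rw [pow_succ', Submodule.mul_smul] at hx
    induction hx using Submodule.smul_induction_on' with
    | add x _ y _ hx hy => simpa using add_mem hx hy
    | smul a ha y hy =>
      rw [← sum_support_decompose ℳ y, Finset.smul_sum, decompose_sum,
        DFinsupp.finsetSum_apply, AddSubgroup.val_finsetSum]
      refine sum_mem fun l _ => ?_
      obtain ⟨k, rfl⟩ : ∃ k, j = k + l := ⟨j - l, by ring⟩
      rw [decompose_smul_add 𝒜 ℳ a (decompose ℳ y l).2]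
      have haI : (decompose 𝒜 a k : R) ∈ I := hI k ha
      have hak := (decompose 𝒜 a k).2
      have hyl := ih hy l
      obtain hl | hl := lt_or_ge l d
      · have h : (decompose ℳ y l : M) ∈ (⊥ : AddSubgroup M) := hd l hl ▸ (decompose ℳ y l).2
        rw [AddSubgroup.mem_bot.mp h, smul_zero]
        exact zero_mem _
      obtain hk | rfl | hk := lt_trichotomy k 0
      · have h : (decompose 𝒜 a k : R) ∈ (⊥ : AddSubgroup R) := hneg k hk ▸ hak
        rw [AddSubgroup.mem_bot.mp h, zero_smul]
        exact zero_mem _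
      · obtain ⟨b, hb⟩ := hsurj _ hak
        rw [← hb] at haI
        rw [← hb, algebraMap_smul, zero_add]
        have h := Submodule.smul_mem_smul (hIJ b haI) hyl
        rw [← Submodule.mul_smul, ← pow_succ'] at h
        exact Submodule.smul_mono_left (Ideal.pow_le_pow_right (by lia)) h
      · exact Submodule.smul_mono_left (Ideal.pow_le_pow_right (by lia))
          (smul_mem_pow_smul_component 𝒜 ℳ h0 _ hak hyl)

lemma toInvLimit_component_bijective [IsNoetherianRing A] [IsLocalRing A]
    [IsAdicComplete (IsLocalRing.maximalIdeal A) A] [IsNoetherianRing R] [Module.Finite R M]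
    (h0 : ∀ a : A, algebraMap A R a ∈ 𝒜 0)
    (hsurj : ∀ r ∈ 𝒜 0, ∃ a : A, algebraMap A R a = r)
    (hneg : ∀ i : ℤ, i < 0 → 𝒜 i = ⊥) {I : Ideal R} (hI : I.IsHomogeneous 𝒜)
    (hI0 : ∀ a : A, algebraMap A R a ∈ I ↔ a ∈ IsLocalRing.maximalIdeal A) (i : ℤ)
    (hp : ∀ ⦃m n : ℕ⦄, m ≤ n →
      AddSubgroup.comap (ℳ i).subtype ((I ^ n • ⊤ : Submodule R M).toAddSubgroup) ≤
      AddSubgroup.comap (ℳ i).subtype ((I ^ m • ⊤ : Submodule R M).toAddSubgroup)) :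
    Function.Bijective (toInvLimit (fun n => AddSubgroup.comap (ℳ i).subtype
      ((I ^ n • ⊤ : Submodule R M).toAddSubgroup)) hp) := by
  have := isNoetherian_component 𝒜 ℳ h0 hsurj i
  have : IsAdicComplete (IsLocalRing.maximalIdeal A) (component 𝒜 ℳ h0 i) :=
    isAdicComplete_of_finite
  obtain ⟨d, hd⟩ := exists_forall_lt_eq_bot 𝒜 ℳ hneg
  let e : ℳ i ≃+ component 𝒜 ℳ h0 i := AddEquiv.refl _
  have he : ∀ (n : ℕ) (x : ℳ i),
      e x ∈ (IsLocalRing.maximalIdeal A ^ n • ⊤ : Submodule A (component 𝒜 ℳ h0 i)) ↔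
        (x : M) ∈ IsLocalRing.maximalIdeal A ^ n • component 𝒜 ℳ h0 i := by
    intro n x
    rw [Submodule.mem_smul_top_iff]
    rfl
  refine toInvLimit_bijective (IsLocalRing.maximalIdeal A) e _ _ (i - d).toNat
    (fun n x hx => ?_) fun n x hx => ?_
  · exact mem_pow_smul_top_of_mem_pow_smul (fun a ha => (hI0 a).mpr ha) n _ ((he n x).mp hx)
  · rw [he]
    have h := decompose_mem_of_mem_pow_smul 𝒜 ℳ h0 hsurj hneg hI (fun a ha => (hI0 a).mp ha) hd
      _ hx i
    rwa [Nat.add_sub_cancel, AddSubgroup.subtype_apply, decompose_of_mem_same ℳ x.2] at h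

end Graded

end Statement0

theorem statement0
    (R : Type*) [CommRing R] (𝒜 : ℤ → AddSubgroup R) [GradedRing 𝒜]
    (hneg : ∀ i : ℤ, i < 0 → 𝒜 i = ⊥)
    -- `R₀ = 𝒜 0` is a Noetherian complete local ring:
    [IsNoetherianRing (𝒜 0)] [IsLocalRing (𝒜 0)]
    [IsAdicComplete (IsLocalRing.maximalIdeal (𝒜 0)) (𝒜 0)]
    -- `R` is finitely generated as an algebra over `R₀`:
    (hfg : ∃ s : Finset R, Subring.closure ((𝒜 0 : Set R) ∪ s) = ⊤)
    (I : Ideal R) (hI : I.IsHomogeneous 𝒜)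
    -- the degree-zero component of `I` is the maximal ideal of `R₀`:
    (hI0 : ∀ x : 𝒜 0, (x : R) ∈ I ↔ x ∈ IsLocalRing.maximalIdeal (𝒜 0))
    (M : Type*) [AddCommGroup M] [Module R M] [Module.Finite R M]
    (ℳ : ℤ → AddSubgroup M) [DirectSum.Decomposition ℳ] [SetLike.GradedSMul 𝒜 ℳ]
    (i : ℤ) :
    Function.Bijective
      (Statement0.toInvLimit
        (fun n => AddSubgroup.comap (ℳ i).subtype
          ((I ^ n • ⊤ : Submodule R M).toAddSubgroup))
        (fun m n h => AddSubgroup.comap_mono (fun x hx =>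
          Submodule.smul_mono_left (Ideal.pow_le_pow_right h) hx))) := by
  have : Algebra.FiniteType (𝒜 0) R := by
    obtain ⟨s, hs⟩ := hfg
    refine ⟨s, top_le_iff.mp fun x _ => ?_⟩
    have hle : Subring.closure ((𝒜 0 : Set R) ∪ s) ≤
        (Algebra.adjoin (𝒜 0) (s : Set R)).toSubring := by
      rw [Subring.closure_le]
      rintro y (hy | hy)
      · exact (Algebra.adjoin (𝒜 0) (s : Set R)).algebraMap_mem ⟨y, hy⟩
      · exact Algebra.subset_adjoin hy
    exact hle (hs ▸ Subring.mem_top x)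
  have : IsNoetherianRing R := Algebra.FiniteType.isNoetherianRing (𝒜 0) R
  let : Module (𝒜 0) M := Module.compHom M (algebraMap (𝒜 0) R)
  have : IsScalarTower (𝒜 0) R M := IsScalarTower.of_algebraMap_smul fun _ _ => rfl
  exact Statement0.toInvLimit_component_bijective (A := 𝒜 0) 𝒜 ℳ (fun a => a.2)
    (fun r hr => ⟨⟨r, hr⟩, rfl⟩) hneg hI hI0 i _
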